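/- Let R and S be commutative Noetherian ℕ-graded rings whose degree-zero components R⁰ and S⁰ are fields, with irrelevant maximal ideals m_R = ⊕_{i>0} R^i and m_S = ⊕_{i>0} S^i, and let φ : R → S be a ring homomorphism which is homogeneous of degree 0 (so that φ(m_R) ⊆ m_S). Let A be a finitely generated non-zero graded R-module and B a finitely generated non-zero graded S-module which is flat as an R-module via φ. Then the S-module A ⊗_R B is Cohen-Macaulay over S if and only if A is Cohen-Macaulay over R and B/m_R B is Cohen-Macaulay over S. -/

import Mathlib

/-- The depth of a module `M` over `R` with respect to an ideal `I`:
the maximal length of an `M`-regular sequence of elements of `I`. -/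
noncomputable def moduleDepth (R : Type*) [CommRing R] (I : Ideal R)
    (M : Type*) [AddCommGroup M] [Module R M] : ℕ∞ :=
  sSup {n : ℕ∞ | ∃ rs : List R, (∀ r ∈ rs, r ∈ I) ∧
    RingTheory.Sequence.IsRegular M rs ∧ (rs.length : ℕ∞) = n}

/-- The dimension of a module `M` over `R`: the Krull dimension of `R / Ann_R M`. -/
noncomputable def moduleDim (R : Type*) [CommRing R]
    (M : Type*) [AddCommGroup M] [Module R M] : WithBot ℕ∞ :=
  ringKrullDim (R ⧸ Module.annihilator R M)

/-- A module `M` is Cohen-Macaulay (w.r.t. the ideal `I`, which is meant to be the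
relevant (graded) maximal ideal of `R`) if `M = 0` or its depth equals its dimension. -/
def IsCohenMacaulayModule (R : Type*) [CommRing R] (I : Ideal R)
    (M : Type*) [AddCommGroup M] [Module R M] : Prop :=
  Subsingleton M ∨ (moduleDepth R I M : WithBot ℕ∞) = moduleDim R M

open scoped TensorProduct

/-- The `S`-module structure on `A ⊗[R] B` coming from the `S`-action on the right
factor `B`, where `S` is an `R`-algebra. -/
noncomputable instance tensorRightModule {R S A B : Type*} [CommRing R] [CommRing S]
    [Algebra R S] [AddCommGroup A] [Module R A] [AddCommGroup B] [Module R B] [Module S B]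
    [IsScalarTower R S B] : Module S (A ⊗[R] B) where
  smul s x := (TensorProduct.comm R A B).symm (s • TensorProduct.comm R A B x)
  one_smul x := by
    show (TensorProduct.comm R A B).symm ((1 : S) • TensorProduct.comm R A B x) = x
    simp
  mul_smul s t x := by
    show (TensorProduct.comm R A B).symm ((s * t) • TensorProduct.comm R A B x) =
      (TensorProduct.comm R A B).symm (s • TensorProduct.comm R A B
        ((TensorProduct.comm R A B).symm (t • TensorProduct.comm R A B x)))
    simp [mul_smul]
  smul_zero s := by
    show (TensorProduct.comm R A B).symm (s • TensorProduct.comm R A B 0) = 0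
    simp
  smul_add s x y := by
    show (TensorProduct.comm R A B).symm (s • TensorProduct.comm R A B (x + y)) =
      (TensorProduct.comm R A B).symm (s • TensorProduct.comm R A B x) +
        (TensorProduct.comm R A B).symm (s • TensorProduct.comm R A B y)
    simp [smul_add]
  add_smul s t x := by
    show (TensorProduct.comm R A B).symm ((s + t) • TensorProduct.comm R A B x) =
      (TensorProduct.comm R A B).symm (s • TensorProduct.comm R A B x) +
        (TensorProduct.comm R A B).symm (t • TensorProduct.comm R A B x)
    simp [add_smul]
  zero_smul x := by
    show (TensorProduct.comm R A B).symm ((0 : S) • TensorProduct.comm R A B x) = 0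
    simp

section Depth

open RingTheory.Sequence CategoryTheory Abelian Pointwise

universe u v w

theorem smul_top_quotSMulTop_ne_top {R M : Type*} [CommRing R] [AddCommGroup M] [Module R M]
    {I : Ideal R} {r : R} (hr : r ∈ I) (hI : I • (⊤ : Submodule R M) ≠ ⊤) :
    I • (⊤ : Submodule R (QuotSMulTop r M)) ≠ ⊤ := by
  by_contra eq
  absurd congrArg (Submodule.comap (Submodule.mkQ _)) eq
  simpa [Submodule.comap_smul_top_of_surjective I _ (Submodule.mkQ_surjective _),
    Submodule.smul_mono_left ((Ideal.span_singleton_le_iff_mem I).mpr hr),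
    ← Submodule.ideal_span_singleton_smul] using hI

theorem exists_isRegular_quotSMulTop_of_small {R : Type u} [CommRing R] [IsNoetherianRing R]
    [Small.{v} R] {M : Type v} [AddCommGroup M] [Module R M] [Module.Finite R M] {I : Ideal R}
    (hI : I • (⊤ : Submodule R M) ≠ ⊤) {x : R} (hx : x ∈ I) (hreg : IsSMulRegular M x) {n : ℕ}
    (h : ∃ rs : List R, rs.length = n + 1 ∧ (∀ r ∈ rs, r ∈ I) ∧ IsRegular M rs) :
    ∃ rs : List R, rs.length = n ∧ (∀ r ∈ rs, r ∈ I) ∧ IsRegular (QuotSMulTop x M) rs := by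
  have h1 :=
    ((ModuleCat.exists_isRegular_tfae I (n + 1) (ModuleCat.of R M) hI.lt_top).out 1 3).mpr h
  refine ((ModuleCat.exists_isRegular_tfae I n (ModuleCat.of R (QuotSMulTop x M))
    (smul_top_quotSMulTop_ne_top hx hI).lt_top).out 1 3).mp fun i hi ↦ ?_
  have zero1 := AddCommGrpCat.isZero_of_iff_subsingleton.mpr (h1 i (by omega))
  have zero2 := AddCommGrpCat.isZero_of_iff_subsingleton.mpr (h1 (i + 1) (by omega))
  have hreg' : IsSMulRegular (ModuleCat.of R M) x := hreg
  exact AddCommGrpCat.subsingleton_of_isZero <| ShortComplex.Exact.isZero_of_both_zeros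
    ((Ext.covariant_sequence_exact₃' _ hreg'.smulShortComplex_shortExact) i (i + 1) rfl)
    (zero1.eq_zero_of_src _) (zero2.eq_zero_of_tgt _)

variable {R : Type u} {M : Type v} [CommRing R] [AddCommGroup M] [Module R M]

/-- An `M`-regular `x ∈ I` is the start of an `M`-regular sequence in `I` of every attained
length. -/
theorem exists_isRegular_quotSMulTop [IsNoetherianRing R] [Module.Finite R M] {I : Ideal R}
    (hI : I • (⊤ : Submodule R M) ≠ ⊤) {x : R} (hx : x ∈ I) (hreg : IsSMulRegular M x) {n : ℕ}
    (h : ∃ rs : List R, rs.length = n + 1 ∧ (∀ r ∈ rs, r ∈ I) ∧ IsRegular M rs) :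
    ∃ rs : List R, rs.length = n ∧ (∀ r ∈ rs, r ∈ I) ∧ IsRegular (QuotSMulTop x M) rs := by
  let e : M ≃ₗ[R] ULift.{u} M := ULift.moduleEquiv.symm
  have : Module.Finite R (ULift.{u} M) := Module.Finite.equiv e
  obtain ⟨rs, hl, hm, hr⟩ := h
  obtain ⟨rs', hl', hm', hr'⟩ := exists_isRegular_quotSMulTop_of_small (M := ULift.{u} M) (I := I)
    (fun h' ↦ hI (by
      have := congrArg (Submodule.map (e.symm : ULift.{u} M →ₗ[R] M)) h'
      simpa [Submodule.map_smul''] using this)) hx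
    ((e.isSMulRegular_congr x).mp hreg) ⟨rs, hl, hm, (e.isRegular_congr rs).mp hr⟩
  exact ⟨rs', hl', hm', ((QuotSMulTop.congr x e).isRegular_congr rs').mpr hr'⟩

/-- All elements of `I` kill some non-zero element of `M`. -/
def HasSocle (I : Ideal R) (M : Type v) [AddCommGroup M] [Module R M] : Prop :=
  ∃ z : M, z ≠ 0 ∧ ∀ r ∈ I, r • z = 0

theorem HasSocle.of_injective {I : Ideal R} {N : Type w} [AddCommGroup N] [Module R N]
    (h : HasSocle I M) (f : M →ₗ[R] N) (hf : Function.Injective f) : HasSocle I N := by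
  obtain ⟨z, hz, h⟩ := h
  exact ⟨f z, fun h0 ↦ hz (hf (by simpa using h0)), fun r hr ↦ by rw [← map_smul, h r hr, map_zero]⟩

/-- A regular sequence in `I` whose quotient has a socle is at least as long as any other. -/
theorem length_le_of_hasSocle [IsNoetherianRing R] {I : Ideal R} (rs : List R) :
    ∀ {M : Type v} [AddCommGroup M] [Module R M] [Module.Finite R M]
    (_ : I • (⊤ : Submodule R M) ≠ ⊤) (_ : ∀ r ∈ rs, r ∈ I) (_ : IsRegular M rs)
    (_ : HasSocle I (M ⧸ Ideal.ofList rs • (⊤ : Submodule R M)))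
    {rs' : List R} (_ : ∀ r ∈ rs', r ∈ I) (_ : IsRegular M rs'), rs'.length ≤ rs.length := by
  induction rs with
  | nil =>
    intro M _ _ _ hI _ _ hs rs' hm' hr'
    obtain ⟨z, hz, h⟩ := hs.of_injective
      (Submodule.quotEquivOfEqBot (Ideal.ofList [] • (⊤ : Submodule R M)) (by simp)).toLinearMap
      (LinearEquiv.injective _)
    match rs' with
    | [] => simp
    | a :: l =>
      exact absurd (((isRegular_cons_iff _ _ _).mp hr').1 (by simpa using h a (hm' a (by simp)))) hz
  | cons x rs ih =>
    intro M _ _ _ hI hm hr hs rs' hm' hr'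
    rw [isRegular_cons_iff] at hr
    rcases hl : rs'.length with _ | n
    · simp
    have hx : x ∈ I := hm x (by simp)
    obtain ⟨l, hl1, hl2, hl3⟩ := exists_isRegular_quotSMulTop hI hx hr.1 ⟨rs', hl, hm', hr'⟩
    have := ih (smul_top_quotSMulTop_ne_top hx hI) (fun r h ↦ hm r (by simp [h])) hr.2
      (hs.of_injective (Submodule.quotOfListConsSMulTopEquivQuotSMulTopInner M x rs).toLinearMap
        (LinearEquiv.injective _)) hl2 hl3
    simp; omega

theorem moduleDepth_eq_length [IsNoetherianRing R] [Module.Finite R M] {I : Ideal R}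
    (hI : I • (⊤ : Submodule R M) ≠ ⊤) {rs : List R} (hm : ∀ r ∈ rs, r ∈ I) (hr : IsRegular M rs)
    (hs : HasSocle I (M ⧸ Ideal.ofList rs • (⊤ : Submodule R M))) :
    moduleDepth R I M = rs.length := by
  refine le_antisymm (sSup_le ?_) (le_sSup ⟨rs, hm, hr, rfl⟩)
  rintro _ ⟨l, hl, hl', rfl⟩
  exact_mod_cast length_le_of_hasSocle rs hI hm hr hs hl hl'

/-- The length of a regular sequence is bounded by the dimension. -/
theorem length_le_supportDim [IsNoetherianRing R] (rs : List R) :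
    ∀ {M : Type v} [AddCommGroup M] [Module R M] [Module.Finite R M] (_ : IsRegular M rs),
      (rs.length : WithBot ℕ∞) ≤ Module.supportDim R M := by
  induction rs with
  | nil =>
    intro M _ _ _ hr
    have := hr.nontrivial
    have h := Module.supportDim_ne_bot_of_nontrivial R M
    obtain ⟨a, ha⟩ := WithBot.ne_bot_iff_exists.mp h
    rw [← ha]
    exact_mod_cast zero_le (a := a)
  | cons x rs ih =>
    intro M _ _ _ hr
    rw [isRegular_cons_iff] at hr
    refine le_trans ?_ (Module.supportDim_quotSMulTop_succ_le_of_notMem_minimalPrimes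
      fun _ ↦ hr.1.notMem_of_mem_minimalPrimes)
    push_cast [List.length_cons]
    gcongr
    exact ih hr.2

theorem moduleDepth_le_moduleDim [IsNoetherianRing R] [Module.Finite R M] [Nontrivial M]
    (I : Ideal R) : (moduleDepth R I M : WithBot ℕ∞) ≤ moduleDim R M := by
  rw [moduleDim, ← Module.supportDim_eq_ringKrullDim_quotient_annihilator]
  obtain ⟨a, ha⟩ := WithBot.ne_bot_iff_exists.mp (Module.supportDim_ne_bot_of_nontrivial R M)
  rw [← ha, WithBot.coe_le_coe]
  refine sSup_le ?_
  rintro _ ⟨l, hl, hl', rfl⟩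
  have := length_le_supportDim l hl'
  rw [← ha] at this
  exact_mod_cast this

/-- If `I` is maximal and contains no `M`-regular element, then `M` has a socle. -/
theorem hasSocle_of_forall_not_isSMulRegular [IsNoetherianRing R] [Module.Finite R M]
    [Nontrivial M] {I : Ideal R} [I.IsMaximal] (h : ∀ x ∈ I, ¬ IsSMulRegular M x) :
    HasSocle I M := by
  have hsub : (I : Set R) ⊆ ⋃ p ∈ associatedPrimes R M, (p : Set R) := by
    rw [biUnion_associatedPrimes_eq_zero_divisors]
    intro x hx
    by_contra hc
    refine h x hx (isSMulRegular_iff_right_eq_zero_of_smul.mpr fun y hy ↦ ?_)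
    by_contra hy0
    exact hc ⟨y, hy0, hy⟩
  have hfin := associatedPrimes.finite R M
  obtain ⟨p, hp, hIp⟩ : ∃ p ∈ associatedPrimes R M, I ≤ p :=
    (Ideal.subset_union_prime_finite hfin (f := id) ⊤ ⊤
      (fun p hp _ _ ↦ hp.isPrime) (I := I)).mp (by simpa using hsub)
  obtain ⟨_, z, hz⟩ := isAssociatedPrime_iff.mp hp
  refine ⟨z, ?_, fun r hr ↦ ?_⟩
  · rintro rfl
    exact hp.isPrime.ne_top (by rw [hz]; simp)
  · have := hIp hr
    rw [hz] at this
    simpa [Submodule.mem_colon_singleton] using this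

theorem isRegular_of_isWeaklyRegular {I : Ideal R} (hI : I • (⊤ : Submodule R M) ≠ ⊤)
    {rs : List R} (hm : ∀ r ∈ rs, r ∈ I) (h : IsWeaklyRegular M rs) : IsRegular M rs :=
  ⟨h, fun h' ↦ hI (top_le_iff.mp (h'.trans_le
    (Submodule.smul_mono_left (Ideal.span_le.mpr fun r hr ↦ hm r (by simpa using hr)))))⟩

/-- Over a maximal ideal, regular sequences extend to ones with a socle in the quotient. -/
theorem exists_isRegular_hasSocle [IsNoetherianRing R] [Module.Finite R M] {I : Ideal R}
    [I.IsMaximal] (hI : I • (⊤ : Submodule R M) ≠ ⊤) (hfin : moduleDim R M ≠ ⊤) :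
    ∃ rs : List R, (∀ r ∈ rs, r ∈ I) ∧ IsRegular M rs ∧
      HasSocle I (M ⧸ Ideal.ofList rs • (⊤ : Submodule R M)) := by
  by_contra! hc
  have key : ∀ n : ℕ, ∃ rs : List R, rs.length = n ∧ (∀ r ∈ rs, r ∈ I) ∧ IsRegular M rs := by
    intro n
    induction n with
    | zero => exact ⟨[], rfl, by simp, isRegular_of_isWeaklyRegular hI (by simp) (by simp)⟩
    | succ n ih =>
      obtain ⟨rs, hl, hm, hr⟩ := ih
      have := hr.quot_ofList_smul_nontrivial ⊤
      have h := hc rs hm hr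
      contrapose! h
      refine hasSocle_of_forall_not_isSMulRegular fun x hx hx' ↦ ?_
      have hm' : ∀ r ∈ rs ++ [x], r ∈ I := by
        intro r hr
        rcases List.mem_append.mp hr with hr | hr
        · exact hm r hr
        · simp_all
      exact h (rs ++ [x]) (by simp [hl]) hm' (isRegular_of_isWeaklyRegular hI hm'
        ((isWeaklyRegular_append_iff _ _ _).mpr ⟨hr.1, by simpa using hx'⟩))
  rw [moduleDim, ← Module.supportDim_eq_ringKrullDim_quotient_annihilator] at hfin
  have hle : ∀ n : ℕ, (n : WithBot ℕ∞) ≤ Module.supportDim R M := fun n ↦ by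
    obtain ⟨rs, rfl, -, hr⟩ := key n
    exact length_le_supportDim rs hr
  generalize Module.supportDim R M = d at hfin hle
  induction d using WithBot.recBotCoe with
  | bot => exact absurd (hle 0) (by simp)
  | coe d =>
    induction d using ENat.recTopCoe with
    | top => exact hfin rfl
    | coe d =>
      have := hle (d + 1)
      have h2 : d + 1 ≤ d := by exact_mod_cast this
      omega

theorem exists_smul_eq_of_mem_map_smul_top {T : Submonoid R} {L : Type*} [CommRing L] [Algebra R L]
    [IsLocalization T L] {N : Type*} [AddCommGroup N] [Module R N] [Module L N]
    [IsScalarTower R L N] (f : M →ₗ[R] N) [IsLocalizedModule T f] (J : Ideal R) {y : N}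
    (hy : y ∈ J.map (algebraMap R L) • (⊤ : Submodule L N)) :
    ∃ s ∈ T, ∃ w ∈ J • (⊤ : Submodule R M), s • y = f w := by
  induction hy using Submodule.smul_induction_on' with
  | smul r hr n _ =>
    obtain ⟨⟨j, s⟩, hs⟩ := (IsLocalization.mem_map_algebraMap_iff T L).mp hr
    obtain ⟨⟨m, t⟩, ht⟩ := IsLocalizedModule.surj T f n
    refine ⟨t * s, (t * s).2, (j : R) • m, Submodule.smul_mem_smul j.2 trivial, ?_⟩
    simp only at hs ht
    have ht' : (t : R) • n = f m := ht
    rw [map_smul, ← ht', mul_smul, ← algebraMap_smul L (s : R), smul_smul, mul_comm, hs,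
      algebraMap_smul, smul_comm]
  | add a _ b _ ha hb =>
    obtain ⟨s, hs, v, hv, h1⟩ := ha
    obtain ⟨t, ht, w, hw, h2⟩ := hb
    refine ⟨s * t, T.mul_mem hs ht, t • v + s • w,
      add_mem (Submodule.smul_mem _ _ hv) (Submodule.smul_mem _ _ hw), ?_⟩
    rw [map_add, map_smul, map_smul, ← h1, ← h2, smul_add, smul_smul, smul_smul, mul_comm t s]

/-- Depth is unchanged by localization at the maximal ideal. -/
theorem moduleDepth_localization [IsNoetherianRing R] [Module.Finite R M] (I : Ideal R)
    [I.IsMaximal] (hI : I • (⊤ : Submodule R M) ≠ ⊤) (hfin : moduleDim R M ≠ ⊤)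
    {L : Type*} [CommRing L] [Algebra R L] [IsLocalization.AtPrime L I] [IsLocalRing L]
    {N : Type*} [AddCommGroup N] [Module R N] [Module L N] [IsScalarTower R L N]
    (f : M →ₗ[R] N) [IsLocalizedModule.AtPrime I f] :
    moduleDepth L (IsLocalRing.maximalIdeal L) N = moduleDepth R I M := by
  have : Module.Finite L N := Module.Finite.of_isLocalizedModule I.primeCompl f
  have : IsNoetherianRing L := IsLocalization.isNoetherianRing I.primeCompl L inferInstance
  have hLI : I.map (algebraMap R L) = IsLocalRing.maximalIdeal L :=
    IsLocalization.AtPrime.map_eq_maximalIdeal I L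
  obtain ⟨rs, hm, hr, z, hz, hs⟩ := exists_isRegular_hasSocle hI hfin
  rw [moduleDepth_eq_length hI hm hr ⟨z, hz, hs⟩]
  have hinj : ∀ (P : Submodule R M) (z : M), z ∉ P → (∀ r ∈ I, r • z ∈ P) →
      ∀ s ∉ I, s • z ∉ P := by
    intro P z hz h s hs hsz
    obtain ⟨t, i, hi, hti⟩ := (Ideal.IsMaximal.exists_inv ‹_› hs)
    apply hz
    rw [← one_smul R z, ← hti, add_smul, mul_smul]
    exact P.add_mem (P.smul_mem _ hsz) (h i hi)
  have hinj' : ∀ (J : Ideal R) (z : M), z ∉ J • (⊤ : Submodule R M) →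
      (∀ r ∈ I, r • z ∈ J • (⊤ : Submodule R M)) →
      f z ∉ J.map (algebraMap R L) • (⊤ : Submodule L N) := by
    intro J z hz h hf
    obtain ⟨s, hs, w, hw, h2⟩ := exists_smul_eq_of_mem_map_smul_top (T := I.primeCompl) f J hf
    rw [← map_smul] at h2
    obtain ⟨c, hc⟩ := IsLocalizedModule.exists_of_eq (S := I.primeCompl) h2
    refine hinj _ z hz h (c * s) (I.primeCompl.mul_mem c.2 hs) ?_
    have hc' : (c : R) • s • z = (c : R) • w := hc
    rw [mul_smul, hc']
    exact Submodule.smul_mem _ _ hw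
  have hN : IsLocalRing.maximalIdeal L • (⊤ : Submodule L N) ≠ ⊤ := by
    obtain ⟨w, -, hw⟩ := SetLike.exists_of_lt hI.lt_top
    rw [← hLI]
    intro h
    exact hinj' I w hw (fun r hr ↦ Submodule.smul_mem_smul hr trivial) (by rw [h]; trivial)
  have hml : ∀ r ∈ rs.map (algebraMap R L), r ∈ IsLocalRing.maximalIdeal L := by
    intro r hr
    obtain ⟨a, ha, rfl⟩ := List.mem_map.mp hr
    exact hLI ▸ Ideal.mem_map_of_mem _ (hm a ha)
  have hr' := isRegular_of_isWeaklyRegular hN hml (hr.1.of_isLocalizedModule L I.primeCompl f)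
  have hsoc : HasSocle (IsLocalRing.maximalIdeal L)
      (N ⧸ Ideal.ofList (rs.map (algebraMap R L)) • (⊤ : Submodule L N)) := by
    obtain ⟨z, rfl⟩ := Submodule.mkQ_surjective _ z
    simp only [Submodule.mkQ_apply, ← Submodule.Quotient.mk_smul, ne_eq,
      Submodule.Quotient.mk_eq_zero] at hz hs
    refine ⟨Submodule.Quotient.mk (f z), ?_, fun r hr ↦ ?_⟩
    · rw [ne_eq, Submodule.Quotient.mk_eq_zero, ← Ideal.map_ofList]
      exact hinj' _ z hz hs
    · rw [← Submodule.Quotient.mk_smul, Submodule.Quotient.mk_eq_zero, ← Ideal.map_ofList]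
      rw [← hLI] at hr
      induction hr using Submodule.span_induction with
      | mem r hr =>
        obtain ⟨a, ha, rfl⟩ := hr
        rw [algebraMap_smul, ← map_smul]
        have : (Ideal.ofList rs • (⊤ : Submodule R M)).map f ≤
            ((Ideal.ofList rs).map (algebraMap R L) • (⊤ : Submodule L N)).restrictScalars R := by
          rw [Submodule.map_smul'', Submodule.smul_le]
          intro r hr n _
          rw [Submodule.restrictScalars_mem, ← algebraMap_smul L r n]
          exact Submodule.smul_mem_smul (Ideal.mem_map_of_mem _ hr) trivial
        exact this (Submodule.mem_map_of_mem (hs a ha))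
      | zero => simp
      | add x y _ _ hx hy => rw [add_smul]; exact add_mem hx hy
      | smul a x _ hx => rw [smul_assoc]; exact Submodule.smul_mem _ _ hx
  simpa using moduleDepth_eq_length hN hml hr' hsoc

end Depth

/-- The module structure on a tensor product coming from the left factor. -/
abbrev tensorLeftModule {R L B A : Type*} [CommRing R] [CommRing L]
    [AddCommGroup A] [Module R A] [AddCommGroup B] [Module R B] [Module L B]
    [SMulCommClass R L B] : Module L (B ⊗[R] A) :=
  TensorProduct.leftModule

section TensorQuotient

attribute [local instance] tensorLeftModule

open RingTheory.Sequence TensorProduct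

variable {R L : Type*} [CommRing R] [CommRing L] [Algebra R L]
  (B : Type*) [AddCommGroup B] [Module R B] [Module L B] [IsScalarTower R L B]
  (A : Type*) [AddCommGroup A] [Module R A]

/-- Quotients of the left factor commute with tensor products. -/
noncomputable def quotSMulTensorEquiv (I : Ideal L) :
    (B ⧸ I • (⊤ : Submodule L B)) ⊗[R] A ≃ₗ[L] (B ⊗[R] A) ⧸ I • (⊤ : Submodule L (B ⊗[R] A)) :=
  AlgebraTensorModule.congr (quotTensorEquivQuotSMul B I).symm (LinearEquiv.refl R A) ≪≫ₗ
    AlgebraTensorModule.assoc R L L (L ⧸ I) B A ≪≫ₗ quotTensorEquivQuotSMul (B ⊗[R] A) I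

theorem range_lTensor_smul_top (J : Ideal R) :
    LinearMap.range (AlgebraTensorModule.lTensor L B (J • (⊤ : Submodule R A)).subtype) =
      J.map (algebraMap R L) • (⊤ : Submodule L (B ⊗[R] A)) := by
  apply le_antisymm
  · rintro _ ⟨x, rfl⟩
    induction x with
    | zero => simp
    | add x y hx hy => rw [map_add]; exact add_mem hx hy
    | tmul b a =>
      obtain ⟨a, ha⟩ := a
      simp only [AlgebraTensorModule.lTensor_tmul, Submodule.subtype_apply]
      induction ha using Submodule.smul_induction_on' with
      | smul r hr n _ =>
        rw [TensorProduct.tmul_smul, TensorProduct.smul_tmul', ← algebraMap_smul L r b,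
          ← TensorProduct.smul_tmul']
        exact Submodule.smul_mem_smul (Ideal.mem_map_of_mem _ hr) trivial
      | add x _ y _ hx hy => rw [TensorProduct.tmul_add]; exact add_mem hx hy
  · rw [Submodule.smul_le]
    intro r hr x _
    refine Submodule.span_induction (p := fun r _ ↦ r • x ∈ LinearMap.range
      (AlgebraTensorModule.lTensor L B (J • (⊤ : Submodule R A)).subtype)) ?_ (by simp)
      (fun _ _ _ _ h h' ↦ by rw [add_smul]; exact add_mem h h')
      (fun a _ _ h ↦ by rw [smul_assoc]; exact Submodule.smul_mem _ _ h) hr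
    rintro _ ⟨r, hr, rfl⟩
    rw [SetLike.mem_coe] at hr
    clear * - hr
    induction x with
    | zero => simp
    | add x y hx hy => rw [smul_add]; exact add_mem hx hy
    | tmul b a =>
      refine ⟨b ⊗ₜ ⟨r • a, Submodule.smul_mem_smul hr trivial⟩, ?_⟩
      rw [AlgebraTensorModule.lTensor_tmul, Submodule.subtype_apply, TensorProduct.tmul_smul,
        TensorProduct.smul_tmul', TensorProduct.smul_tmul', algebraMap_smul]

/-- Quotients of the right factor commute with tensor products. -/
noncomputable def tensorQuotSMulEquiv (J : Ideal R) :
    B ⊗[R] (A ⧸ J • (⊤ : Submodule R A)) ≃ₗ[L]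
      (B ⊗[R] A) ⧸ J.map (algebraMap R L) • (⊤ : Submodule L (B ⊗[R] A)) :=
  ((Submodule.quotEquivOfEq _ _ (by
    rw [← range_lTensor_smul_top]
    refine SetLike.ext fun x ↦ ?_
    exact Iff.symm <| (lTensor_exact B (LinearMap.exact_subtype_mkQ (J • (⊤ : Submodule R A)))
      (Submodule.mkQ_surjective _)) x)) ≪≫ₗ
    LinearMap.quotKerEquivOfSurjective
      (AlgebraTensorModule.lTensor L B (J • (⊤ : Submodule R A)).mkQ)
      (LinearMap.lTensor_surjective B (Submodule.mkQ_surjective _))).symm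

/-- Tensoring with a cyclic module. -/
noncomputable def tensorCyclicEquiv (J : Ideal R) :
    B ⊗[R] (R ⧸ J) ≃ₗ[L] B ⧸ J.map (algebraMap R L) • (⊤ : Submodule L B) :=
  AlgebraTensorModule.congr (LinearEquiv.refl L B)
    (Submodule.quotEquivOfEq J (J • (⊤ : Submodule R R)) (by simp)) ≪≫ₗ
  tensorQuotSMulEquiv B R J ≪≫ₗ
  Submodule.Quotient.equiv _ _ (AlgebraTensorModule.rid R L B) (by
    rw [Submodule.map_smul'', Submodule.map_top,
      LinearEquiv.range])

end TensorQuotient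

section LocalFlatness

attribute [local instance] tensorLeftModule

open RingTheory.Sequence TensorProduct

universe u v w

variable {R L : Type*} [CommRing R] [CommRing L] [Algebra R L]
  {B : Type*} [AddCommGroup B] [Module R B] [Module L B] [IsScalarTower R L B]

theorem isSMulRegular_tensor_of_pow_smul [IsNoetherianRing R] [Module.Flat R B] {m : Ideal R}
    [m.IsMaximal] {x : L}
    (hx : IsSMulRegular (B ⊗[R] (R ⧸ m)) x)
    (A : Type v) [AddCommGroup A] [Module R A] [Module.Finite R A] (k : ℕ)
    (hk : m ^ k ≤ Module.annihilator R A) : IsSMulRegular (B ⊗[R] A) x := by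
  induction ‹Module.Finite R A› using
    IsNoetherianRing.induction_on_isQuotientEquivQuotientPrime R with
  | subsingleton N => exact fun a b _ ↦ Subsingleton.elim _ _
  | quotient N p e =>
    have hp : m ≤ p.1 := by
      refine p.2.le_of_pow_le (n := k) ?_
      rwa [e.annihilator_eq, Ideal.annihilator_quotient] at hk
    have hp : m = p.1 := ‹m.IsMaximal›.eq_of_le p.2.ne_top hp
    rw [← hp] at e
    exact ((AlgebraTensorModule.congr (LinearEquiv.refl L B) e).isSMulRegular_congr x).mpr hx
  | exact N₁ N₂ N₃ f g hf hg hfg h₁ h₃ =>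
    have h₁ := h₁ (hk.trans (f.annihilator_le_of_injective hf))
    have h₃ := h₃ (hk.trans (g.annihilator_le_of_surjective hg))
    refine isSMulRegular_of_range_eq_ker (f := AlgebraTensorModule.lTensor L B f)
      (g := AlgebraTensorModule.lTensor L B g) ?_ ?_ h₁ h₃
    · exact Module.Flat.lTensor_preserves_injective_linearMap f hf
    · refine SetLike.ext fun x ↦ ?_
      exact ((lTensor_exact B hfg hg) x).symm

theorem finite_tensorProduct (R : Type*) {L : Type*} [CommRing R] [CommRing L] [Algebra R L]
    (B : Type*) [AddCommGroup B] [Module R B] [Module L B] [IsScalarTower R L B]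
    [Module.Finite L B] (A : Type*) [AddCommGroup A] [Module R A] [Module.Finite R A] :
    Module.Finite L (B ⊗[R] A) :=
  Module.Finite.equiv (AlgebraTensorModule.cancelBaseChange R L L B A)

theorem isSMulRegular_tensor [IsNoetherianRing R] [IsNoetherianRing L] [IsLocalRing L]
    [Module.Finite L B] [Module.Flat R B] {m : Ideal R} [m.IsMaximal]
    (hm : m.map (algebraMap R L) ≤ IsLocalRing.maximalIdeal L) {x : L}
    (hx : IsSMulRegular (B ⊗[R] (R ⧸ m)) x)
    (A : Type v) [AddCommGroup A] [Module R A] [Module.Finite R A] :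
    IsSMulRegular (B ⊗[R] A) x := by
  rw [isSMulRegular_iff_right_eq_zero_of_smul]
  intro z hz
  have := finite_tensorProduct R (L := L) B A
  have : IsNoetherian L (B ⊗[R] A) := isNoetherian_of_isNoetherianRing_of_finite L _
  have key := Ideal.iInf_pow_smul_eq_bot_of_isLocalRing (M := B ⊗[R] A)
    (IsLocalRing.maximalIdeal L) (Ideal.IsPrime.ne_top inferInstance)
  rw [← Submodule.mem_bot L, ← key, Submodule.mem_iInf]
  intro k
  have hk := isSMulRegular_tensor_of_pow_smul hx (A ⧸ m ^ k • (⊤ : Submodule R A)) k (by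
    intro r hr
    rw [Module.mem_annihilator]
    intro y
    obtain ⟨y, rfl⟩ := Submodule.mkQ_surjective _ y
    rw [← map_smul, Submodule.mkQ_apply, Submodule.Quotient.mk_eq_zero]
    exact Submodule.smul_mem_smul hr trivial)
  rw [(tensorQuotSMulEquiv B A (m ^ k)).isSMulRegular_congr,
    isSMulRegular_iff_right_eq_zero_of_smul] at hk
  have h := hk (Submodule.Quotient.mk z) (by rw [← Submodule.Quotient.mk_smul, hz]; simp)
  rw [Submodule.Quotient.mk_eq_zero] at h
  refine Submodule.smul_mono_left ?_ h
  rw [Ideal.map_pow]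
  exact Ideal.pow_right_mono hm k

end LocalFlatness

section LocalDepth

open RingTheory.Sequence TensorProduct Pointwise

attribute [local instance] tensorLeftModule

universe u v w

variable {R L : Type*} [CommRing R] [CommRing L] [Algebra R L]
  {B : Type*} [AddCommGroup B] [Module R B] [Module L B] [IsScalarTower R L B]

theorem exists_sum_smul_of_mem_map_span {l : ℕ} (f : Fin l → R) {b : B}
    (hb : b ∈ (Ideal.span (Set.range f)).map (algebraMap R L) • (⊤ : Submodule L B)) :
    ∃ c : Fin l → B, ∑ i, f i • c i = b := by
  let g : (Fin l → B) →ₗ[L] B := ∑ i, algebraMap R L (f i) • LinearMap.proj i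
  have hg : ∀ c, g c = ∑ i, f i • c i := fun c ↦ by simp [g]
  suffices h : (Ideal.span (Set.range f)).map (algebraMap R L) • (⊤ : Submodule L B) ≤
      LinearMap.range g by
    obtain ⟨c, hc⟩ := h hb
    exact ⟨c, by rw [← hg, hc]⟩
  rw [Submodule.smul_le, Ideal.map_span]
  intro r hr x _
  refine Submodule.span_induction (p := fun r _ ↦ r • x ∈ LinearMap.range g) ?_ (by simp)
    (fun _ _ _ _ h h' ↦ by rw [add_smul]; exact add_mem h h')
    (fun a _ _ h ↦ by rw [smul_assoc]; exact Submodule.smul_mem _ _ h) hr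
  rintro _ ⟨_, ⟨i, rfl⟩, rfl⟩
  refine ⟨Pi.single i x, ?_⟩
  rw [hg, Finset.sum_eq_single i (by intro j _ hj; simp [hj]) (by simp)]
  simp

theorem flat_quotSMulTop [IsNoetherianRing R] [IsNoetherianRing L] [IsLocalRing L]
    [Module.Finite L B] [Module.Flat R B] {m : Ideal R} [m.IsMaximal]
    (hm : m.map (algebraMap R L) ≤ IsLocalRing.maximalIdeal L) {x : L}
    (hx : IsSMulRegular (B ⊗[R] (R ⧸ m)) x) : Module.Flat R (QuotSMulTop x B) := by
  refine Module.Flat.of_forall_isTrivialRelation fun {l f b} hfb ↦ ?_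
  choose b' hb using fun i ↦ Submodule.mkQ_surjective _ (b i)
  have h0 :
      ((Submodule.mkQ (x • (⊤ : Submodule L B))).restrictScalars R) (∑ i, f i • b' i) = 0 := by
    simpa [map_sum, hb] using hfb
  obtain ⟨c, -, hc⟩ := (Submodule.Quotient.mk_eq_zero _).mp h0
  replace hc : x • c = ∑ i, f i • b' i := hc
  have hreg := isSMulRegular_tensor hm hx (R ⧸ Ideal.span (Set.range f))
  rw [(tensorCyclicEquiv B _).isSMulRegular_congr,
    isSMulRegular_iff_right_eq_zero_of_smul] at hreg
  have hc' := hreg (Submodule.Quotient.mk c) (by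
    rw [← Submodule.Quotient.mk_smul, hc, Submodule.Quotient.mk_eq_zero]
    refine Submodule.sum_mem _ fun i _ ↦ ?_
    rw [← algebraMap_smul L (f i) (b' i)]
    exact Submodule.smul_mem_smul (Ideal.mem_map_of_mem _ (Ideal.subset_span ⟨i, rfl⟩)) trivial)
  rw [Submodule.Quotient.mk_eq_zero] at hc'
  obtain ⟨d, hd⟩ := exists_sum_smul_of_mem_map_span f hc'
  have hrel : ∑ i, f i • (b' i - x • d i) = 0 := by
    simp_rw [smul_sub, Finset.sum_sub_distrib, ← hc, ← hd, Finset.smul_sum, smul_comm x]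
    simp
  obtain ⟨k, a, y, h1, h2⟩ := Module.Flat.isTrivialRelation_of_sum_smul_eq_zero hrel
  refine ⟨k, a, fun j ↦ Submodule.Quotient.mk (y j), fun i ↦ ?_, h2⟩
  have h3 := congrArg ((Submodule.mkQ (x • (⊤ : Submodule L B))).restrictScalars R) (h1 i)
  rw [map_sub, map_sum, LinearMap.restrictScalars_apply, LinearMap.restrictScalars_apply, hb,
    Submodule.mkQ_apply _ (x • d i),
    (Submodule.Quotient.mk_eq_zero (x • (⊤ : Submodule L B))).mpr
      (Submodule.smul_mem_pointwise_smul _ _ _ trivial)] at h3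
  simpa using h3

/-- `QuotSMulTop` of the left factor commutes with tensor products. -/
noncomputable def quotSMulTopTensorEquiv {R L : Type*} [CommRing R] [CommRing L] [Algebra R L]
    (B : Type*) [AddCommGroup B] [Module R B] [Module L B] [IsScalarTower R L B]
    (A : Type*) [AddCommGroup A] [Module R A] (x : L) :
    QuotSMulTop x B ⊗[R] A ≃ₗ[L] QuotSMulTop x (B ⊗[R] A) :=
  AlgebraTensorModule.congr (Submodule.quotEquivOfEq _ _
    (Submodule.ideal_span_singleton_smul x ⊤).symm) (LinearEquiv.refl R A) ≪≫ₗ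
  quotSMulTensorEquiv B A (Ideal.span {x}) ≪≫ₗ
  Submodule.quotEquivOfEq _ _ (Submodule.ideal_span_singleton_smul x ⊤)

theorem isWeaklyRegular_tensor [IsNoetherianRing R] [IsNoetherianRing L] [IsLocalRing L]
    {m : Ideal R} [m.IsMaximal]
    (hm : m.map (algebraMap R L) ≤ IsLocalRing.maximalIdeal L) (rs : List L) :
    ∀ {B : Type w} [AddCommGroup B] [Module R B] [Module L B] [IsScalarTower R L B]
      [Module.Finite L B] [Module.Flat R B] (_ : IsWeaklyRegular (B ⊗[R] (R ⧸ m)) rs),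
      Module.Flat R (B ⧸ Ideal.ofList rs • (⊤ : Submodule L B)) ∧
        ∀ (A : Type v) [AddCommGroup A] [Module R A] [Module.Finite R A],
          IsWeaklyRegular (B ⊗[R] A) rs := by
  induction rs with
  | nil =>
    intro B _ _ _ _ _ _ _
    refine ⟨?_, fun A _ _ _ ↦ .nil _ _⟩
    exact Module.Flat.of_linearEquiv ((Submodule.quotEquivOfEqBot _ (by simp)).restrictScalars R)
  | cons x rs ih =>
    intro B _ _ _ _ _ _ h
    rw [isWeaklyRegular_cons_iff] at h
    have := flat_quotSMulTop hm h.1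
    obtain ⟨h1, h2⟩ := ih (((quotSMulTopTensorEquiv B (R ⧸ m) x).isWeaklyRegular_congr rs).mpr h.2)
    refine ⟨Module.Flat.of_linearEquiv
      ((Submodule.quotOfListConsSMulTopEquivQuotSMulTopInner B x rs).restrictScalars R),
      fun A _ _ _ ↦ ?_⟩
    rw [isWeaklyRegular_cons_iff]
    exact ⟨isSMulRegular_tensor hm h.1 A,
      ((quotSMulTopTensorEquiv B A x).isWeaklyRegular_congr rs).mp (h2 A)⟩

theorem hasSocle_tensor [Module.Flat R B] {m : Ideal R} {I : Ideal L}
    (hB : HasSocle I (B ⊗[R] (R ⧸ m))) {A : Type v} [AddCommGroup A] [Module R A]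
    [hm : m.IsMaximal] (hA : HasSocle m A) : HasSocle I (B ⊗[R] A) := by
  obtain ⟨z, hz, hmz⟩ := hA
  have hker : LinearMap.ker (LinearMap.toSpanSingleton R A z) = m :=
    (hm.eq_of_le (fun h ↦ hz (by
      have : (1 : R) ∈ LinearMap.ker (LinearMap.toSpanSingleton R A z) := h ▸ trivial
      simpa using this)) fun r hr ↦ by simpa using hmz r hr).symm
  let f : (R ⧸ m) →ₗ[R] A := Submodule.liftQ m (LinearMap.toSpanSingleton R A z) hker.ge
  have hf : Function.Injective f :=
    LinearMap.ker_eq_bot.mp (Submodule.ker_liftQ_eq_bot _ _ _ hker.le)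
  exact hB.of_injective (AlgebraTensorModule.lTensor L B f)
    (Module.Flat.lTensor_preserves_injective_linearMap f hf)

theorem maximalIdeal_smul_top_ne_top [IsLocalRing L] (M : Type*) [AddCommGroup M] [Module L M]
    [Module.Finite L M] [Nontrivial M] {I : Ideal L} (hI : I ≤ IsLocalRing.maximalIdeal L) :
    I • (⊤ : Submodule L M) ≠ ⊤ := by
  intro h
  refine top_ne_bot (α := Submodule L M) (Submodule.eq_bot_of_le_smul_of_le_jacobson_bot I ⊤
    Module.Finite.fg_top h.ge ?_)
  rwa [IsLocalRing.jacobson_eq_maximalIdeal _ bot_ne_top]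

/-- The quotient modulo `I • ⊤` is functorial for isomorphisms. -/
noncomputable def quotSMulTopCongr {L M N : Type*} [CommRing L] [AddCommGroup M] [Module L M]
    [AddCommGroup N] [Module L N] (I : Ideal L) (e : M ≃ₗ[L] N) :
    (M ⧸ I • (⊤ : Submodule L M)) ≃ₗ[L] N ⧸ I • (⊤ : Submodule L N) :=
  Submodule.Quotient.equiv _ _ e
    (by rw [Submodule.map_smul'', Submodule.map_top, LinearEquiv.range])

/-- Quotienting successively by `I` and `J`. -/
noncomputable def quotSMulTopQuotSMulTopEquiv {L : Type*} [CommRing L] (M : Type*) [AddCommGroup M]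
    [Module L M] (I J : Ideal L) :
    ((M ⧸ I • (⊤ : Submodule L M)) ⧸ J • (⊤ : Submodule L (M ⧸ I • (⊤ : Submodule L M)))) ≃ₗ[L]
      M ⧸ (I ⊔ J) • (⊤ : Submodule L M) :=
  Submodule.quotEquivOfEq _ _ (by
    rw [Submodule.map_smul'', Submodule.map_top, Submodule.range_mkQ]) ≪≫ₗ
  Submodule.quotientQuotientEquivQuotientSup (I • (⊤ : Submodule L M)) (J • ⊤) ≪≫ₗ
  Submodule.quotEquivOfEq _ _ (Submodule.sup_smul ..).symm

/-- Additivity of depth along a flat local base change. -/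
theorem moduleDepth_tensor [IsNoetherianRing R] [IsNoetherianRing L] [IsLocalRing L]
    [Module.Finite L B] [Module.Flat R B] [Nontrivial B] {m : Ideal R} [m.IsMaximal]
    (hm : m.map (algebraMap R L) ≤ IsLocalRing.maximalIdeal L)
    (A : Type v) [AddCommGroup A] [Module R A] [Module.Finite R A]
    (hA : m • (⊤ : Submodule R A) ≠ ⊤) (hfin : moduleDim R A ≠ ⊤) :
    moduleDepth L (IsLocalRing.maximalIdeal L) (B ⊗[R] A) =
      moduleDepth R m A + moduleDepth L (IsLocalRing.maximalIdeal L)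
        (B ⧸ m.map (algebraMap R L) • (⊤ : Submodule L B)) := by
  have := finite_tensorProduct R (L := L) B A
  have hB : Nontrivial (B ⧸ m.map (algebraMap R L) • (⊤ : Submodule L B)) :=
    Submodule.Quotient.nontrivial_iff.mpr (maximalIdeal_smul_top_ne_top B hm)
  have hB' := maximalIdeal_smul_top_ne_top (L := L)
    (B ⧸ m.map (algebraMap R L) • (⊤ : Submodule L B)) le_rfl
  obtain ⟨as, has, hras, hsas⟩ := exists_isRegular_hasSocle hA hfin
  obtain ⟨bs, hbs, hrbs, hsbs⟩ := exists_isRegular_hasSocle (R := L) hB'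
    ((ringKrullDim_quotient_le _).trans_lt ringKrullDim_lt_top).ne
  rw [moduleDepth_eq_length hA has hras hsas, moduleDepth_eq_length hB' hbs hrbs hsbs]
  obtain ⟨hflat, hreg⟩ := isWeaklyRegular_tensor hm bs
    (((tensorCyclicEquiv B m).isWeaklyRegular_congr bs).mpr hrbs.1)
  let e := tensorQuotSMulEquiv (L := L) B A (Ideal.ofList as)
  have hreg' : IsWeaklyRegular (B ⊗[R] A) (as.map (algebraMap R L) ++ bs) := by
    rw [isWeaklyRegular_append_iff, ← Ideal.map_ofList, ← e.isWeaklyRegular_congr,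
      isWeaklyRegular_map_algebraMap_iff]
    exact ⟨hras.1.isWeaklyRegular_lTensor, hreg _⟩
  have hsoc : HasSocle (IsLocalRing.maximalIdeal L) ((B ⊗[R] A) ⧸
      Ideal.ofList (as.map (algebraMap R L) ++ bs) • (⊤ : Submodule L (B ⊗[R] A))) := by
    have h1 : HasSocle (IsLocalRing.maximalIdeal L)
        ((B ⧸ Ideal.ofList bs • (⊤ : Submodule L B)) ⊗[R] (R ⧸ m)) :=
      hsbs.of_injective ((quotSMulTopCongr (Ideal.ofList bs) (tensorCyclicEquiv B m)).symm ≪≫ₗ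
        (quotSMulTensorEquiv B (R ⧸ m) (Ideal.ofList bs)).symm).toLinearMap
        (LinearEquiv.injective _)
    have e' :=
      quotSMulTensorEquiv B (A ⧸ Ideal.ofList as • (⊤ : Submodule R A)) (Ideal.ofList bs) ≪≫ₗ
      quotSMulTopCongr (Ideal.ofList bs) e ≪≫ₗ
      quotSMulTopQuotSMulTopEquiv (B ⊗[R] A) ((Ideal.ofList as).map (algebraMap R L))
        (Ideal.ofList bs)
    rw [Ideal.ofList_append, ← Ideal.map_ofList]
    exact (hasSocle_tensor h1 hsas).of_injective e'.toLinearMap e'.injective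
  have hmem : ∀ r ∈ as.map (algebraMap R L) ++ bs, r ∈ IsLocalRing.maximalIdeal L := by
    intro r hr
    obtain hr | hr := List.mem_append.mp hr
    · obtain ⟨a, ha, rfl⟩ := List.mem_map.mp hr
      exact hm (Ideal.mem_map_of_mem _ (has a ha))
    · exact hbs r hr
  have hnt : Nontrivial (B ⊗[R] A) := by
    obtain ⟨z, hz, -⟩ := hsoc
    obtain ⟨w, rfl⟩ := Submodule.mkQ_surjective _ z
    exact ⟨w, 0, fun h ↦ hz (by rw [h, map_zero])⟩
  have hne := maximalIdeal_smul_top_ne_top (L := L) (B ⊗[R] A) le_rfl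
  rw [moduleDepth_eq_length hne hmem (isRegular_of_isWeaklyRegular hne hmem hreg') hsoc]
  simp

end LocalDepth

section GlobalDepth

open RingTheory.Sequence TensorProduct

attribute [local instance] tensorLeftModule

theorem moduleDepth_congr {R M N : Type*} [CommRing R] [AddCommGroup M] [Module R M]
    [AddCommGroup N] [Module R N] (I : Ideal R) (e : M ≃ₗ[R] N) :
    moduleDepth R I M = moduleDepth R I N := by
  simp only [moduleDepth, e.isRegular_congr]

theorem moduleDim_congr {R M N : Type*} [CommRing R] [AddCommGroup M] [Module R M]
    [AddCommGroup N] [Module R N] (e : M ≃ₗ[R] N) : moduleDim R M = moduleDim R N := by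
  unfold moduleDim
  rw [e.annihilator_eq]

theorem smul_top_ne_top_of_annihilator_le {R M : Type*} [CommRing R] [AddCommGroup M] [Module R M]
    [Module.Finite R M] {I : Ideal R} (hI : I ≠ ⊤) (h : Module.annihilator R M ≤ I) :
    I • (⊤ : Submodule R M) ≠ ⊤ := by
  intro h'
  obtain ⟨r, hr, h0⟩ := Submodule.exists_sub_one_mem_and_smul_eq_zero_of_fg_of_le_smul I
    (⊤ : Submodule R M) Module.Finite.fg_top h'.ge
  refine hI ((Ideal.eq_top_iff_one I).mpr ?_)
  rw [← sub_sub_cancel r 1]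
  exact I.sub_mem (h (Module.mem_annihilator.mpr fun m ↦ h0 m trivial)) hr

variable {R S : Type*} [CommRing R] [CommRing S] [Algebra R S]
  {B : Type*} [AddCommGroup B] [Module R B] [Module S B] [IsScalarTower R S B]

theorem flat_of_isLocalizedModule (T : Submonoid S) {N : Type*} [AddCommGroup N] [Module R N]
    [Module S N] [IsScalarTower R S N] (g : B →ₗ[S] N) [IsLocalizedModule T g] [Module.Flat R B] :
    Module.Flat R N := by
  rw [Module.Flat.iff_lTensor_injective']
  intro I
  have := IsLocalizedModule.map_injective T (AlgebraTensorModule.rTensor R I g)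
    (AlgebraTensorModule.rTensor R R g) (AlgebraTensorModule.lTensor S B I.subtype)
    (Module.Flat.lTensor_preserves_injective_linearMap I.subtype I.subtype_injective)
  rw [IsLocalizedModule.map_lTensor] at this
  exact this

theorem moduleDepth_tensor_of_isLocalizedModule [IsNoetherianRing R] [IsNoetherianRing S]
    [Module.Finite S B] [Module.Flat R B] {m : Ideal R} [m.IsMaximal] {n : Ideal S} [n.IsMaximal]
    (hm : m.map (algebraMap R S) ≤ n)
    (A : Type*) [AddCommGroup A] [Module R A] [Module.Finite R A]
    (hA : m • (⊤ : Submodule R A) ≠ ⊤) (hfin : moduleDim R A ≠ ⊤)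
    (hBA : n • (⊤ : Submodule S (B ⊗[R] A)) ≠ ⊤) (hfin' : moduleDim S (B ⊗[R] A) ≠ ⊤)
    (hBm : n • (⊤ : Submodule S (B ⧸ m.map (algebraMap R S) • (⊤ : Submodule S B))) ≠ ⊤)
    (hfin'' : moduleDim S (B ⧸ m.map (algebraMap R S) • (⊤ : Submodule S B)) ≠ ⊤)
    {L N : Type*} [CommRing L] [IsLocalRing L] [Algebra S L] [IsLocalization.AtPrime L n]
    [Algebra R L] [IsScalarTower R S L] [AddCommGroup N] [Nontrivial N] [Module R N] [Module S N]
    [Module L N] [IsScalarTower R S N] [IsScalarTower S L N]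
    (g : B →ₗ[S] N) [IsLocalizedModule n.primeCompl g] :
    moduleDepth S n (B ⊗[R] A) =
      moduleDepth R m A + moduleDepth S n (B ⧸ m.map (algebraMap R S) • (⊤ : Submodule S B)) := by
  have : IsScalarTower R L N := .of_algebraMap_smul fun r x ↦ by
    rw [IsScalarTower.algebraMap_apply R S L, algebraMap_smul, algebraMap_smul]
  have : Module.Flat R N := flat_of_isLocalizedModule n.primeCompl g
  have : IsNoetherianRing L := IsLocalization.isNoetherianRing n.primeCompl L inferInstance
  have : Module.Finite L N := Module.Finite.of_isLocalizedModule n.primeCompl g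
  have hm' : m.map (algebraMap R L) ≤ IsLocalRing.maximalIdeal L := by
    rw [IsScalarTower.algebraMap_eq R S L, ← Ideal.map_map,
      ← IsLocalization.AtPrime.map_eq_maximalIdeal n L]
    exact Ideal.map_mono hm
  have := finite_tensorProduct R (L := S) B A
  have := finite_tensorProduct R (L := S) B (R ⧸ m)
  have h := moduleDepth_tensor (B := N) hm' A hA hfin
  have e := tensorCyclicEquiv (L := S) B m
  rw [← moduleDepth_congr _ (tensorCyclicEquiv (L := L) N m),
    moduleDepth_localization n hBA hfin' (AlgebraTensorModule.rTensor R A g),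
    moduleDepth_localization n ?_ (by rwa [moduleDim_congr e])
      (AlgebraTensorModule.rTensor R (R ⧸ m) g), moduleDepth_congr n e] at h
  · exact h
  · intro htop
    refine hBm ?_
    rw [← e.range, LinearMap.range_eq_map, ← Submodule.map_smul'', htop]

/-- Additivity of depth along a flat base change at a pair of maximal ideals. -/
theorem moduleDepth_tensor_of_isMaximal [IsNoetherianRing R] [IsNoetherianRing S]
    [Module.Finite S B] [Module.Flat R B] {m : Ideal R} [m.IsMaximal] {n : Ideal S} [n.IsMaximal]
    (hm : m.map (algebraMap R S) ≤ n)
    (A : Type*) [AddCommGroup A] [Module R A] [Module.Finite R A]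
    (hA : m • (⊤ : Submodule R A) ≠ ⊤) (hfin : moduleDim R A ≠ ⊤)
    (hB : Module.annihilator S B ≤ n)
    (hBA : n • (⊤ : Submodule S (B ⊗[R] A)) ≠ ⊤) (hfin' : moduleDim S (B ⊗[R] A) ≠ ⊤)
    (hBm : n • (⊤ : Submodule S (B ⧸ m.map (algebraMap R S) • (⊤ : Submodule S B))) ≠ ⊤)
    (hfin'' : moduleDim S (B ⧸ m.map (algebraMap R S) • (⊤ : Submodule S B)) ≠ ⊤) :
    moduleDepth S n (B ⊗[R] A) =
      moduleDepth R m A + moduleDepth S n (B ⧸ m.map (algebraMap R S) • (⊤ : Submodule S B)) := by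
  have : Nontrivial (LocalizedModule n.primeCompl B) :=
    (Module.mem_support_iff_of_finite (p := ⟨n, inferInstance⟩)).mpr hB
  let i : Module R (LocalizedModule n.primeCompl B) :=
    Module.compHom _ (algebraMap R S)
  have : @IsScalarTower R S (LocalizedModule n.primeCompl B) _ _ i.toSMul :=
    @IsScalarTower.of_algebraMap_smul R S _ _ _ _ _ i.toSMul fun r x ↦ rfl
  exact @moduleDepth_tensor_of_isLocalizedModule _ _ _ _ _ _ _ _ _ _ _ _ _ _ _ _ _ _ hm A
    _ _ _ hA hfin hBA hfin' hBm hfin'' (Localization.AtPrime n) _ _ _ _ _ _ _ _ _ i _ _ this _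
    (LocalizedModule.mkLinearMap n.primeCompl B) _

end GlobalDepth

section Annihilator

open TensorProduct

attribute [local instance] tensorLeftModule

variable {R S : Type*} [CommRing R] [CommRing S] [Algebra R S]
  {B : Type*} [AddCommGroup B] [Module R B] [Module S B] [IsScalarTower R S B]
  {A : Type*} [AddCommGroup A] [Module R A]

theorem annihilator_tensor_le_pi (ι : Type*) [Finite ι] :
    Module.annihilator S (B ⊗[R] A) ≤ Module.annihilator S (B ⊗[R] (ι → A)) := by
  classical
  have := Fintype.ofFinite ι
  intro s hs
  rw [Module.mem_annihilator] at hs ⊢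
  intro x
  induction x with
  | zero => simp
  | add x y hx hy => rw [smul_add, hx, hy, add_zero]
  | tmul b f =>
    have h (i : ι) : s • b ⊗ₜ[R] (Pi.single i (f i) : ι → A) = 0 := by
      have := congr_arg (AlgebraTensorModule.lTensor S B (LinearMap.single R (fun _ : ι ↦ A) i))
        (hs (b ⊗ₜ f i))
      simpa only [map_smul, AlgebraTensorModule.lTensor_tmul, map_zero,
        LinearMap.single_apply] using this
    rw [← Finset.univ_sum_single f, tmul_sum, Finset.smul_sum, Finset.sum_eq_zero fun i _ ↦ h i]

theorem annihilator_tensor [Module.Finite R A] [Module.Flat R B] :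
    Module.annihilator S (B ⊗[R] A) = Module.annihilator S
      (B ⧸ (Module.annihilator R A).map (algebraMap R S) • (⊤ : Submodule S B)) := by
  rw [← (tensorCyclicEquiv (L := S) B (Module.annihilator R A)).annihilator_eq]
  obtain ⟨k, g, hg⟩ := Module.Finite.exists_fin (R := R) (M := A)
  apply le_antisymm
  · refine (annihilator_tensor_le_pi (Fin k)).trans ?_
    let f : R →ₗ[R] (Fin k → A) := LinearMap.pi fun i ↦ LinearMap.toSpanSingleton R A (g i)
    have hf : LinearMap.ker f = Module.annihilator R A := by
      ext r
      rw [← Submodule.annihilator_top, ← hg, Submodule.mem_annihilator_span]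
      simp [f, funext_iff]
    refine LinearMap.annihilator_le_of_injective (AlgebraTensorModule.lTensor S B
      (Submodule.liftQ _ f hf.ge)) ?_
    exact Module.Flat.lTensor_preserves_injective_linearMap _
      (LinearMap.ker_eq_bot.mp (Submodule.ker_liftQ_eq_bot _ _ _ hf.le))
  · refine (annihilator_tensor_le_pi (Fin k)).trans ?_
    let f : (Fin k → R ⧸ Module.annihilator R A) →ₗ[R] A :=
      LinearMap.lsum R _ R fun i ↦ Submodule.liftQ _ (LinearMap.toSpanSingleton R A (g i))
        fun r hr ↦ Module.mem_annihilator.mp hr (g i)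
    refine LinearMap.annihilator_le_of_surjective (AlgebraTensorModule.lTensor S B f) ?_
    refine LinearMap.lTensor_surjective B ?_
    rw [← LinearMap.range_eq_top, eq_top_iff, ← hg, Submodule.span_le]
    rintro _ ⟨i, rfl⟩
    refine ⟨Pi.single i (Submodule.Quotient.mk 1), ?_⟩
    rw [LinearMap.lsum_piSingle]
    exact one_smul R (g i)

theorem annihilator_quotient_smul_top_le_iff [Module.Finite S B] {I n : Ideal S} [hn : n.IsPrime] :
    Module.annihilator S (B ⧸ I • (⊤ : Submodule S B)) ≤ n ↔ Module.annihilator S B ⊔ I ≤ n := by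
  have h := Set.ext_iff.mp (Module.support_quotient (M := B) I) ⟨n, hn⟩
  rw [Module.mem_support_iff_of_finite, Set.mem_inter_iff, Module.mem_support_iff_of_finite] at h
  rw [sup_le_iff]
  exact h

theorem moduleDim_quotient_smul_top [Module.Finite S B] (I : Ideal S) :
    moduleDim S (B ⧸ I • (⊤ : Submodule S B)) =
      ringKrullDim (S ⧸ (Module.annihilator S B ⊔ I)) := by
  have h : PrimeSpectrum.zeroLocus
      (Module.annihilator S (B ⧸ I • (⊤ : Submodule S B)) : Set S) =
      PrimeSpectrum.zeroLocus (Module.annihilator S B ⊔ I : Ideal S) :=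
    Set.ext fun n ↦ annihilator_quotient_smul_top_le_iff
  rw [moduleDim, ringKrullDim_quotient, ringKrullDim_quotient, h]

end Annihilator

section GoingDown

theorem map_quotQuotEquivQuotOfLE {R : Type*} [CommRing R] {I J : Ideal R} (h : I ≤ J)
    (n : Ideal R) :
    ((n.map (Ideal.Quotient.mk I)).map (Ideal.Quotient.mk (J.map (Ideal.Quotient.mk I)))).map
      (DoubleQuot.quotQuotEquivQuotOfLE h) = n.map (Ideal.Quotient.mk J) := by
  rw [← DoubleQuot.quotQuotEquivQuotOfLE_comp_quotQuotMk h, ← Ideal.map_map, Ideal.map_map]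
  rfl

open TensorProduct

attribute [local instance] tensorLeftModule

variable {R S : Type*} [CommRing R] [CommRing S] [Algebra R S]
  (B : Type*) [AddCommGroup B] [Module R B] [Module S B] [IsScalarTower R S B]

/-- Going down inside the support of a finite module which is flat over the base. -/
theorem exists_isPrime_comap_eq_of_flat [IsNoetherianRing S] [Module.Finite S B] [Module.Flat R B]
    {p : Ideal R} [p.IsPrime] {Q : Ideal S} [Q.IsPrime] (hQ : Module.annihilator S B ≤ Q)
    (hpQ : p.map (algebraMap R S) ≤ Q) :
    ∃ P ≤ Q, P.IsPrime ∧ Module.annihilator S B ≤ P ∧ P.comap (algebraMap R S) = p := by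
  let M := B ⧸ p.map (algebraMap R S) • (⊤ : Submodule S B)
  obtain ⟨P, hP, hPQ⟩ := Ideal.exists_minimalPrimes_le
    (annihilator_quotient_smul_top_le_iff.mpr (sup_le hQ hpQ))
  obtain ⟨hPprime, x, hx⟩ := isAssociatedPrime_iff.mp
    (Module.associatedPrimes.minimalPrimes_annihilator_subset_associatedPrimes S M hP)
  have hle := annihilator_quotient_smul_top_le_iff.mp hP.1.2
  refine ⟨P, hPQ, hPprime, le_sup_left.trans hle, le_antisymm (fun r hr ↦ ?_)
    (Ideal.map_le_iff_le_comap.mp (le_sup_right.trans hle))⟩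
  by_contra hrp
  have hreg : IsSMulRegular (R ⧸ p) r := by
    rw [isSMulRegular_iff_right_eq_zero_of_smul]
    intro y
    obtain ⟨y, rfl⟩ := Ideal.Quotient.mk_surjective y
    intro h
    rw [← Ideal.Quotient.mk_eq_mk, ← Submodule.Quotient.mk_smul, Submodule.Quotient.mk_eq_zero] at h
    rw [Ideal.Quotient.eq_zero_iff_mem]
    exact (Ideal.IsPrime.mem_or_mem ‹_› h).resolve_left hrp
  let e := tensorCyclicEquiv (L := S) B p
  have hrx : algebraMap R S r • x = 0 := by
    rwa [Ideal.mem_comap, hx, Submodule.mem_colon_singleton, Submodule.mem_bot] at hr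
  have h0 : r • e.symm x = 0 := by
    rw [← algebraMap_smul S, ← map_smul, hrx, map_zero]
  have hinj := Module.Flat.lTensor_preserves_injective_linearMap (M := B)
    (LinearMap.lsmul R (R ⧸ p) r) hreg
  have hx0 : e.symm x = 0 := by
    refine hinj ?_
    rw [map_zero, ← h0]
    generalize e.symm x = y
    induction y with
    | zero => simp
    | add x y hx hy => rw [map_add, hx, hy, smul_add]
    | tmul b y => simp
  rw [LinearEquiv.map_eq_zero_iff] at hx0
  refine hPprime.ne_top ?_
  rw [hx, hx0]
  exact (Ideal.eq_top_iff_one _).mpr (by simp [Submodule.mem_colon_singleton])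

theorem hasGoingDown_quotient [IsNoetherianRing S] [Module.Finite S B] [Module.Flat R B]
    (I : Ideal R) {K : Ideal S} (hK : K = Module.annihilator S B ⊔ I.map (algebraMap R S))
    [Algebra (R ⧸ I) (S ⧸ K)] (h : ∀ r, algebraMap (R ⧸ I) (S ⧸ K) (Ideal.Quotient.mk I r) =
      Ideal.Quotient.mk K (algebraMap R S r)) :
    Algebra.HasGoingDown (R ⧸ I) (S ⧸ K) where
  exists_ideal_le_liesOver_of_lt {p} _ Q _ hpQ := by
    have hKQ : K ≤ Q.comap (Ideal.Quotient.mk K) :=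
      Ideal.mk_ker.ge.trans (Ideal.comap_mono bot_le)
    have : (Q.comap (Ideal.Quotient.mk K)).IsPrime := Ideal.comap_isPrime _ _
    have : (p.comap (Ideal.Quotient.mk I)).IsPrime := Ideal.comap_isPrime _ _
    obtain ⟨P, hPQ, hP, hAP, hPp⟩ := exists_isPrime_comap_eq_of_flat B
      (p := p.comap (Ideal.Quotient.mk I)) (Q := Q.comap (Ideal.Quotient.mk K))
      ((le_sup_left.trans hK.ge).trans hKQ) (Ideal.map_le_iff_le_comap.mpr fun r hr ↦ by
        have := hpQ.le hr
        rwa [Ideal.mem_comap, h] at this)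
    have hKP : K ≤ P := hK.le.trans <| sup_le hAP <| Ideal.map_le_iff_le_comap.mpr <| by
      rw [hPp]
      exact Ideal.mk_ker.ge.trans (Ideal.comap_mono bot_le)
    have hcomap : (P.map (Ideal.Quotient.mk K)).comap (Ideal.Quotient.mk K) = P :=
      Ideal.comap_map_mk hKP
    refine ⟨P.map (Ideal.Quotient.mk K), Ideal.map_le_iff_le_comap.mpr hPQ,
      Ideal.map_isPrime_of_surjective Ideal.Quotient.mk_surjective (by rwa [Ideal.mk_ker]), ⟨?_⟩⟩
    ext r
    obtain ⟨r, rfl⟩ := Ideal.Quotient.mk_surjective r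
    rw [← Ideal.mem_comap, ← hPp, Ideal.mem_comap, Ideal.mem_comap, h,
      ← Ideal.mem_comap (f := Ideal.Quotient.mk K), hcomap]

/-- The dimension formula for a finite module which is flat over the base. -/
theorem height_map_quotient_mk_eq_add [IsNoetherianRing R] [IsNoetherianRing S]
    [Module.Finite S B] [Module.Flat R B]
    {m : Ideal R} [m.IsPrime] {n : Ideal S} [n.IsPrime] (hmn : n.comap (algebraMap R S) = m)
    (hB : Module.annihilator S B ≤ n) {I : Ideal R} (hI : I ≤ m) :
    (n.map (Ideal.Quotient.mk (Module.annihilator S B ⊔ I.map (algebraMap R S)))).height =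
      (m.map (Ideal.Quotient.mk I)).height +
      (n.map (Ideal.Quotient.mk (Module.annihilator S B ⊔ m.map (algebraMap R S)))).height := by
  set J := Module.annihilator S B
  set K := J ⊔ I.map (algebraMap R S) with hK
  set K' := J ⊔ m.map (algebraMap R S) with hK'
  have hKK' : K ≤ K' := sup_le_sup_left (Ideal.map_mono hI) _
  have hKn : K ≤ n := sup_le hB (Ideal.map_le_iff_le_comap.mpr (hI.trans hmn.ge))
  let _ : Algebra (R ⧸ I) (S ⧸ K) := Ideal.Quotient.algebraQuotientOfLEComap
    (Ideal.map_le_iff_le_comap.mp le_sup_right)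
  have hmk (r : R) : algebraMap (R ⧸ I) (S ⧸ K) (Ideal.Quotient.mk I r) =
    Ideal.Quotient.mk K (algebraMap R S r) := rfl
  have := hasGoingDown_quotient B I rfl hmk
  have : (m.map (Ideal.Quotient.mk I)).IsPrime :=
    Ideal.map_isPrime_of_surjective Ideal.Quotient.mk_surjective (by rwa [Ideal.mk_ker])
  have : (n.map (Ideal.Quotient.mk K)).IsPrime :=
    Ideal.map_isPrime_of_surjective Ideal.Quotient.mk_surjective (by rwa [Ideal.mk_ker])
  have : (n.map (Ideal.Quotient.mk K)).LiesOver (m.map (Ideal.Quotient.mk I)) := by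
    constructor
    ext r
    obtain ⟨r, rfl⟩ := Ideal.Quotient.mk_surjective r
    rw [Ideal.mem_comap, hmk, ← Ideal.mem_comap, ← Ideal.mem_comap, Ideal.comap_map_mk hKn,
      Ideal.comap_map_mk hI, ← hmn, Ideal.mem_comap]
  have hX : (m.map (Ideal.Quotient.mk I)).map (algebraMap (R ⧸ I) (S ⧸ K)) =
      K'.map (Ideal.Quotient.mk K) := by
    have : J.map (Ideal.Quotient.mk K) = ⊥ := by
      rw [← le_bot_iff, ← Ideal.map_quotient_self K]
      exact Ideal.map_mono le_sup_left
    rw [hK', Ideal.map_sup, this, bot_sup_eq, Ideal.map_map, Ideal.map_map]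
    rfl
  rw [Ideal.height_eq_height_add_of_liesOver_of_hasGoingDown (m.map (Ideal.Quotient.mk I)), hX,
    ← (DoubleQuot.quotQuotEquivQuotOfLE hKK').height_map, map_quotQuotEquivQuotOfLE]

end GoingDown

section GradedDimension

open Polynomial

theorem isMaximal_map_quotient_mk {R : Type*} [CommRing R] {m I : Ideal R} [m.IsMaximal]
    (hI : I ≤ m) : (m.map (Ideal.Quotient.mk I)).IsMaximal :=
  Ideal.IsMaximal.map_of_surjective_of_ker_le Ideal.Quotient.mk_surjective (by simpa using hI)

/-- If `R` carries an action of the multiplicative monoid `𝔸¹` which contracts every closed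
subscheme onto the point `m`, then the dimension of `R` is attained at `m`. -/
theorem ringKrullDim_eq_height_of_coaction {R : Type*} [CommRing R] [IsNoetherianRing R]
    (m : Ideal R) [m.IsMaximal] (θ : R →+* R[X])
    (hθ : ∀ x, ∃ (f : R[X]) (N : ℕ), eval₂RingHom θ X f = C x * X ^ N)
    (hθm : ∀ (Q : Ideal R) [Q.IsPrime], ∀ x, (θ x).coeff 0 ∈ Q → x ∈ m) :
    ringKrullDim R = m.height := by
  refine le_antisymm ((ringKrullDim_le_iff_height_le _).mpr fun Q hQ ↦ ?_)
    (Ideal.height_le_ringKrullDim_of_ne_top Ideal.IsPrime.ne_top')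
  let g : PrimeSpectrum R → PrimeSpectrum R[X] := fun p ↦
    ⟨(p.asIdeal.map C).comap (eval₂RingHom θ X), Ideal.IsPrime.comap _⟩
  have hg : StrictMono g := by
    refine Monotone.strictMono_of_injective
      (fun p q hpq ↦ Ideal.comap_mono (Ideal.map_mono hpq)) fun p q hpq ↦ ?_
    have key : ∀ {p q : PrimeSpectrum R}, g p = g q → p.asIdeal ≤ q.asIdeal := by
      intro p q hpq x hx
      obtain ⟨f, N, hf⟩ := hθ x
      have hfp : f ∈ (g p).asIdeal := by
        rw [Ideal.mem_comap, hf]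
        exact Ideal.mul_mem_right _ _ (Ideal.mem_map_of_mem _ hx)
      rw [hpq, Ideal.mem_comap, hf, Ideal.mem_map_C_iff] at hfp
      simpa using hfp N
    exact PrimeSpectrum.ext (le_antisymm (key hpq) (key hpq.symm))
  let M : Ideal R[X] := m.comap constantCoeff
  have hM : M.IsMaximal := Ideal.comap_isMaximal_of_surjective _ constantCoeff_surjective
  have : M.LiesOver m := ⟨by ext x; simp [M, Ideal.mem_comap]⟩
  have hlt : g ⟨Q, hQ⟩ < ⟨M, hM.isPrime⟩ := by
    refine lt_of_le_of_ne (fun f hf ↦ ?_) fun h ↦ ?_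
    · refine hθm Q (constantCoeff f) ?_
      have h0 : constantCoeff.comp (eval₂RingHom θ X) =
          (constantCoeff.comp θ).comp (constantCoeff (R := R)) := by
        ext <;> simp
      have hf0 : constantCoeff (eval₂RingHom θ X f) = (θ (constantCoeff f)).coeff 0 :=
        DFunLike.congr_fun h0 f
      exact hf0 ▸ Ideal.mem_map_C_iff.mp hf 0
    · have hX : (X : R[X]) ∈ (g ⟨Q, hQ⟩).asIdeal := by
        rw [h]
        simp [M]
      have := Ideal.mem_map_C_iff.mp hX 1
      simp only [coe_eval₂RingHom, eval₂_X, coeff_X_one] at this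
      exact hQ.ne_top ((Ideal.eq_top_iff_one _).mpr this)
  have h := (add_le_add_left (Order.height_le_height_apply_of_strictMono g hg ⟨Q, hQ⟩) 1).trans
    (Order.height_add_one_le hlt)
  rw [← PrimeSpectrum.height_eq_orderHeight, ← PrimeSpectrum.height_eq_orderHeight,
    Polynomial.height_eq_height_add_one m M] at h
  exact_mod_cast (WithTop.add_le_add_iff_right WithTop.one_ne_top).mp h

variable {R : Type*} [CommRing R] (𝒜 : ℕ → AddSubgroup R) [GradedRing 𝒜]

/-- The ring homomorphism `∑ xᵢ ↦ ∑ xᵢ Xⁱ`, where `xᵢ` is homogeneous of degree `i`. -/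
noncomputable def gradedCoaction : R →+* R[X] :=
  (DirectSum.toSemiring (fun i ↦ (monomial i).toAddMonoidHom.comp (𝒜 i).subtype)
    monomial_zero_one (fun _ _ ↦ (monomial_mul_monomial _ _ _ _).symm)).comp
    (DirectSum.decomposeRingEquiv 𝒜 : R →+* _)

theorem gradedCoaction_of_mem {i : ℕ} {x : R} (hx : x ∈ 𝒜 i) :
    gradedCoaction 𝒜 x = monomial i x := by
  have h : (DirectSum.decomposeRingEquiv 𝒜 : R →+* _) x = DirectSum.of (𝒜 ·) i ⟨x, hx⟩ :=
    DirectSum.decompose_of_mem 𝒜 hx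
  rw [gradedCoaction, RingHom.comp_apply, h]
  exact DirectSum.toAddMonoid_of (fun i ↦ (monomial i).toAddMonoidHom.comp (𝒜 i).subtype) i ⟨x, hx⟩

theorem coeff_gradedCoaction (x : R) (i : ℕ) :
    (gradedCoaction 𝒜 x).coeff i = DirectSum.decompose 𝒜 x i := by
  induction x using DirectSum.Decomposition.inductionOn 𝒜 with
  | zero => simp
  | add x y hx hy => simp [hx, hy]
  | @homogeneous j x =>
    rw [gradedCoaction_of_mem 𝒜 x.2, coeff_monomial, DirectSum.decompose_coe]
    split_ifs with h
    · subst h; simp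
    · rw [DirectSum.of_eq_of_ne _ _ _ (Ne.symm h)]; simp

theorem isMaximal_irrelevant (h0 : IsField (𝒜 0)) :
    (HomogeneousIdeal.irrelevant 𝒜).toIdeal.IsMaximal := by
  have : (HomogeneousIdeal.irrelevant 𝒜).toIdeal = RingHom.ker (GradedRing.projZeroRingHom' 𝒜) := by
    ext x
    rw [RingHom.mem_ker, Subtype.ext_iff]
    rfl
  rw [this]
  let _ := h0.toField
  exact RingHom.ker_isMaximal_of_surjective (GradedRing.projZeroRingHom' 𝒜)
    (GradedRing.projZeroRingHom'_surjective 𝒜)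

variable {𝒜}

/-- The degree zero part of an element of a proper homogeneous ideal vanishes. -/
theorem mem_irrelevant_of_decompose_zero_mem (h0 : IsField (𝒜 0)) {I : Ideal R} (hI : I ≠ ⊤)
    {x : R} (hx : (DirectSum.decompose 𝒜 x 0 : R) ∈ I) :
    x ∈ (HomogeneousIdeal.irrelevant 𝒜).toIdeal := by
  by_contra h
  obtain ⟨y, hy⟩ := h0.mul_inv_cancel (a := DirectSum.decompose 𝒜 x 0)
    fun hx0 ↦ h (congrArg Subtype.val hx0)
  refine hI ((Ideal.eq_top_iff_one _).mpr ?_)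
  have : (DirectSum.decompose 𝒜 x 0 : R) * y = 1 := congrArg Subtype.val hy
  exact this ▸ I.mul_mem_right _ hx

theorem le_irrelevant (h0 : IsField (𝒜 0)) {I : Ideal R} (hI : I ≠ ⊤) (hIh : I.IsHomogeneous 𝒜) :
    I ≤ (HomogeneousIdeal.irrelevant 𝒜).toIdeal :=
  fun _ hx ↦ mem_irrelevant_of_decompose_zero_mem h0 hI (hIh 0 hx)

/-- The dimension of a graded quotient is attained at the irrelevant ideal. -/
theorem ringKrullDim_quotient_eq_height [IsNoetherianRing R] (h0 : IsField (𝒜 0)) {I : Ideal R}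
    (hI : I ≠ ⊤) (hIh : I.IsHomogeneous 𝒜) :
    ringKrullDim (R ⧸ I) =
      ((HomogeneousIdeal.irrelevant 𝒜).toIdeal.map (Ideal.Quotient.mk I)).height := by
  have := isMaximal_irrelevant 𝒜 h0
  have := isMaximal_map_quotient_mk (le_irrelevant h0 hI hIh)
  let θ : R ⧸ I →+* (R ⧸ I)[X] :=
    Ideal.Quotient.lift I ((mapRingHom (Ideal.Quotient.mk I)).comp (gradedCoaction 𝒜)) fun x hx ↦ by
      ext i
      simpa [coeff_gradedCoaction, Ideal.Quotient.eq_zero_iff_mem] using hIh i hx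
  have hθ (x : R) :
      θ (Ideal.Quotient.mk I x) = (gradedCoaction 𝒜 x).map (Ideal.Quotient.mk I) := rfl
  refine ringKrullDim_eq_height_of_coaction _ θ (fun x ↦ ?_) fun Q _ x hx ↦ ?_
  · obtain ⟨x, rfl⟩ := Ideal.Quotient.mk_surjective x
    induction x using DirectSum.Decomposition.inductionOn 𝒜 with
    | zero => exact ⟨0, 0, by simp⟩
    | @homogeneous i x =>
      refine ⟨C (Ideal.Quotient.mk I x), i, ?_⟩
      simp [hθ, gradedCoaction_of_mem 𝒜 x.2, C_mul_X_pow_eq_monomial]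
    | add x y hx hy =>
      obtain ⟨f, k, hf⟩ := hx
      obtain ⟨g, l, hg⟩ := hy
      refine ⟨f * X ^ l + g * X ^ k, k + l, ?_⟩
      rw [map_add, map_mul, map_mul, hf, hg, map_add, C_add]
      simp
      ring
  · obtain ⟨x, rfl⟩ := Ideal.Quotient.mk_surjective x
    rw [hθ, coeff_map, coeff_gradedCoaction] at hx
    exact Ideal.mem_map_of_mem _ (mem_irrelevant_of_decompose_zero_mem h0
      (Ideal.comap_ne_top (Ideal.Quotient.mk I) (Ideal.IsPrime.ne_top ‹_›)) hx)

theorem isHomogeneous_map {S : Type*} [CommRing S] {ℬ : ℕ → AddSubgroup S} [GradedRing ℬ]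
    {f : R →+* S} (hf : ∀ (i : ℕ) (x : R), x ∈ 𝒜 i → f x ∈ ℬ i) {I : Ideal R}
    (hI : I.IsHomogeneous 𝒜) : (I.map f).IsHomogeneous ℬ :=
  (HomogeneousIdeal.map (⟨f, fun h ↦ hf _ _ h⟩ : 𝒜 →+*ᵍ ℬ) ⟨I, hI⟩).isHomogeneous

theorem map_irrelevant_le {S : Type*} [CommRing S] {ℬ : ℕ → AddSubgroup S} [GradedRing ℬ]
    {f : R →+* S} (hf : ∀ (i : ℕ) (x : R), x ∈ 𝒜 i → f x ∈ ℬ i) :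
    (HomogeneousIdeal.irrelevant 𝒜).toIdeal.map f ≤ (HomogeneousIdeal.irrelevant ℬ).toIdeal := by
  rw [HomogeneousIdeal.irrelevant_eq_span, Ideal.map_span, Ideal.span_le]
  rintro _ ⟨x, hx, rfl⟩
  obtain ⟨i, hi, hx⟩ := Set.mem_iUnion₂.mp hx
  exact HomogeneousIdeal.mem_irrelevant_of_mem ℬ hi (hf i x hx)

theorem isHomogeneous_annihilator {A : Type*} [AddCommGroup A] [Module R A]
    (ℳ : ℕ → AddSubgroup A) [DirectSum.Decomposition ℳ] [SetLike.GradedSMul 𝒜 ℳ] :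
    (Module.annihilator R A).IsHomogeneous 𝒜 := by
  intro i r hr
  rw [Module.mem_annihilator] at hr ⊢
  intro a
  induction a using DirectSum.Decomposition.inductionOn ℳ with
  | zero => simp
  | add x y hx hy => rw [smul_add, hx, hy, add_zero]
  | @homogeneous j a =>
    have key : ∀ r : R, (DirectSum.decompose ℳ (r • (a : A)) (i + j) : A) =
        (DirectSum.decompose 𝒜 r i : R) • (a : A) := by
      intro r
      induction r using DirectSum.Decomposition.inductionOn 𝒜 with
      | zero => simp
      | add x y hx hy => simp [add_smul, hx, hy]
      | @homogeneous k r =>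
        have hmem : (r : R) • (a : A) ∈ ℳ (k + j) := SetLike.GradedSMul.smul_mem r.2 a.2
        by_cases h : k = i
        · subst h
          rw [DirectSum.decompose_of_mem_same ℳ hmem, DirectSum.decompose_of_mem_same 𝒜 r.2]
        · rw [DirectSum.decompose_of_mem_ne ℳ hmem (by lia),
            DirectSum.decompose_of_mem_ne 𝒜 r.2 h, zero_smul]
    rw [← key, hr, DirectSum.decompose_zero, DirectSum.zero_apply, ZeroMemClass.coe_zero]

end GradedDimension

section BaseChange

open HomogeneousIdeal

attribute [local instance] tensorLeftModule

/-- The swap isomorphism, linear over the ring acting on `B`. -/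
noncomputable def tensorRightEquivLeft (R S A B : Type*) [CommRing R] [CommRing S]
    [Algebra R S] [AddCommGroup A] [Module R A] [AddCommGroup B] [Module R B] [Module S B]
    [IsScalarTower R S B] :
    @LinearEquiv S S _ _ (RingHom.id S) (RingHom.id S) _ _ (A ⊗[R] B) (B ⊗[R] A) _ _
      tensorRightModule tensorLeftModule :=
  @LinearEquiv.mk S S _ _ (RingHom.id S) (RingHom.id S) _ _ (A ⊗[R] B) (B ⊗[R] A) _ _
    tensorRightModule tensorLeftModule
    (@LinearMap.mk S S _ _ (RingHom.id S) (A ⊗[R] B) (B ⊗[R] A) _ _ tensorRightModule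
      tensorLeftModule (TensorProduct.comm R A B).toAddHom
      fun s x ↦ (TensorProduct.comm R A B).apply_symm_apply (s • TensorProduct.comm R A B x))
    (TensorProduct.comm R A B).symm
    (TensorProduct.comm R A B).left_inv (TensorProduct.comm R A B).right_inv

theorem isCohenMacaulayModule_iff {R : Type*} [CommRing R] (I : Ideal R) (M : Type*)
    [AddCommGroup M] [Module R M] [Nontrivial M] :
    IsCohenMacaulayModule R I M ↔ (moduleDepth R I M : WithBot ℕ∞) = moduleDim R M :=
  or_iff_right (not_subsingleton M)

theorem isCohenMacaulayModule_congr {R M N : Type*} [CommRing R] [AddCommGroup M] [Module R M]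
    [AddCommGroup N] [Module R N] (I : Ideal R) (e : M ≃ₗ[R] N) :
    IsCohenMacaulayModule R I M ↔ IsCohenMacaulayModule R I N := by
  rw [IsCohenMacaulayModule, IsCohenMacaulayModule, moduleDepth_congr I e, moduleDim_congr e,
    e.toEquiv.subsingleton_congr]

theorem nontrivial_of_smul_top_ne_top {R M : Type*} [CommRing R] [AddCommGroup M] [Module R M]
    {I : Ideal R} (h : I • (⊤ : Submodule R M) ≠ ⊤) : Nontrivial M := by
  by_contra hM
  rw [not_nontrivial_iff_subsingleton] at hM
  exact h (Subsingleton.elim _ _)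

variable {R S : Type*} [CommRing R] [CommRing S] [IsNoetherianRing R] [IsNoetherianRing S]
  [Algebra R S] {𝒜 : ℕ → AddSubgroup R} [GradedRing 𝒜] {ℬ : ℕ → AddSubgroup S} [GradedRing ℬ]

theorem add_eq_add_iff_of_le {a b x y : ℕ∞} (hx : x ≠ ⊤) (hy : y ≠ ⊤) (hax : a ≤ x)
    (hby : b ≤ y) : a + b = x + y ↔ a = x ∧ b = y := by
  lift x to ℕ using hx
  lift y to ℕ using hy
  lift a to ℕ using (hax.trans_lt (ENat.natCast_lt_top x)).ne
  lift b to ℕ using (hby.trans_lt (ENat.natCast_lt_top y)).ne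
  norm_cast at *
  lia

theorem height_map_quotient_mk_ne_top {R : Type*} [CommRing R] [IsNoetherianRing R] {m I : Ideal R}
    [m.IsMaximal] (hI : I ≤ m) : (m.map (Ideal.Quotient.mk I)).height ≠ ⊤ :=
  have := isMaximal_map_quotient_mk hI
  Ideal.height_ne_top_of_isPrime

/-- The main theorem, for the tensor product `B ⊗[R] A` with its left module structure. -/
theorem isCohenMacaulayModule_tensor_iff (hR0 : IsField (𝒜 0)) (hS0 : IsField (ℬ 0))
    (hφ : ∀ (i : ℕ) (x : R), x ∈ 𝒜 i → algebraMap R S x ∈ ℬ i)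
    (A : Type*) [AddCommGroup A] [Module R A] [Module.Finite R A] [Nontrivial A]
    (ℳ : ℕ → AddSubgroup A) [DirectSum.Decomposition ℳ] [SetLike.GradedSMul 𝒜 ℳ]
    (B : Type*) [AddCommGroup B] [Module R B] [Module S B] [IsScalarTower R S B]
    [Module.Finite S B] [Nontrivial B] [Module.Flat R B]
    (𝒩 : ℕ → AddSubgroup B) [DirectSum.Decomposition 𝒩] [SetLike.GradedSMul ℬ 𝒩] :
    IsCohenMacaulayModule S (irrelevant ℬ).toIdeal (B ⊗[R] A) ↔
      IsCohenMacaulayModule R (irrelevant 𝒜).toIdeal A ∧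
        IsCohenMacaulayModule S (irrelevant ℬ).toIdeal
          (B ⧸ (irrelevant 𝒜).toIdeal.map (algebraMap R S) • (⊤ : Submodule S B)) := by
  have hmap := map_irrelevant_le hφ
  have hIh : (Module.annihilator R A).IsHomogeneous 𝒜 := isHomogeneous_annihilator ℳ
  have hJh : (Module.annihilator S B).IsHomogeneous ℬ := isHomogeneous_annihilator 𝒩
  have hIJh := hJh.sup (isHomogeneous_map hφ hIh)
  have hmJh := hJh.sup (isHomogeneous_map hφ (irrelevant 𝒜).isHomogeneous)
  have hI : Module.annihilator R A ≠ ⊤ := Module.annihilator_eq_top_iff.not.mpr (not_subsingleton A)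
  have hJ := le_irrelevant hS0 (Module.annihilator_eq_top_iff.not.mpr (not_subsingleton B)) hJh
  have hIm := le_irrelevant hR0 hI hIh
  have hm := isMaximal_irrelevant 𝒜 hR0
  have hn := isMaximal_irrelevant ℬ hS0
  set m := (irrelevant 𝒜).toIdeal
  set n := (irrelevant ℬ).toIdeal
  set I := Module.annihilator R A
  set J := Module.annihilator S B
  let F := B ⧸ m.map (algebraMap R S) • (⊤ : Submodule S B)
  have hcomap : n.comap (algebraMap R S) = m :=
    (hm.eq_of_le (Ideal.comap_ne_top _ hn.ne_top) (Ideal.map_le_iff_le_comap.mp hmap)).symm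
  have hJmn : J ⊔ m.map (algebraMap R S) ≤ n := sup_le hJ hmap
  have hJIn : J ⊔ I.map (algebraMap R S) ≤ n :=
    (sup_le_sup_left (Ideal.map_mono hIm) J).trans hJmn
  have hdimA : moduleDim R A = (m.map (Ideal.Quotient.mk I)).height :=
    ringKrullDim_quotient_eq_height hR0 hI hIh
  have hdimF : moduleDim S F =
      (n.map (Ideal.Quotient.mk (J ⊔ m.map (algebraMap R S)))).height :=
    (moduleDim_quotient_smul_top _).trans
      (ringKrullDim_quotient_eq_height hS0 (ne_top_of_le_ne_top hn.ne_top hJmn) hmJh)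
  have hdimT : moduleDim S (B ⊗[R] A) =
      (n.map (Ideal.Quotient.mk (J ⊔ I.map (algebraMap R S)))).height := by
    rw [moduleDim, annihilator_tensor, ← moduleDim, moduleDim_quotient_smul_top]
    exact ringKrullDim_quotient_eq_height hS0 (ne_top_of_le_ne_top hn.ne_top hJIn) hIJh
  have hadd := height_map_quotient_mk_eq_add B hcomap hJ hIm
  have hfinA := height_map_quotient_mk_ne_top hIm
  have hfinF := height_map_quotient_mk_ne_top hJmn
  have hfinT := height_map_quotient_mk_ne_top hJIn
  have := finite_tensorProduct (L := S) R B A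
  have hA : m • (⊤ : Submodule R A) ≠ ⊤ := smul_top_ne_top_of_annihilator_le hm.ne_top hIm
  have hT : n • (⊤ : Submodule S (B ⊗[R] A)) ≠ ⊤ :=
    smul_top_ne_top_of_annihilator_le hn.ne_top
      (annihilator_tensor.trans_le (annihilator_quotient_smul_top_le_iff.mpr hJIn))
  have hF : n • (⊤ : Submodule S F) ≠ ⊤ :=
    smul_top_ne_top_of_annihilator_le hn.ne_top (annihilator_quotient_smul_top_le_iff.mpr hJmn)
  have := nontrivial_of_smul_top_ne_top hT
  have := nontrivial_of_smul_top_ne_top hF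
  have hdepth := moduleDepth_tensor_of_isMaximal hmap A hA (hdimA ▸ mod_cast hfinA) hJ hT
    (hdimT ▸ mod_cast hfinT) hF (hdimF ▸ mod_cast hfinF)
  have hleA := moduleDepth_le_moduleDim (M := A) m
  have hleF := moduleDepth_le_moduleDim (M := F) n
  rw [hdimA, WithBot.coe_le_coe] at hleA
  rw [hdimF, WithBot.coe_le_coe] at hleF
  rw [isCohenMacaulayModule_iff, isCohenMacaulayModule_iff, isCohenMacaulayModule_iff, hdimA, hdimT,
    hdimF, WithBot.coe_inj, WithBot.coe_inj, WithBot.coe_inj, hdepth, hadd]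
  exact add_eq_add_iff_of_le hfinA hfinF hleA hleF

end BaseChange


/-- **Statement 0.** For Noetherian ℕ-graded rings `R`, `S` with degree-zero fields,
a degree-zero homomorphism `φ : R → S` (encoded as an `R`-algebra structure on `S`),
a finitely generated non-zero graded `R`-module `A`, and a finitely generated non-zero
graded `S`-module `B` flat over `R`, we have
`depth_S (A ⊗[R] B) = depth_R A + depth_S (B / m_R B)`. -/
theorem isCM_baseChange_iff
    (R S : Type*) [CommRing R] [CommRing S] [IsNoetherianRing R] [IsNoetherianRing S]
    [Algebra R S]
    (𝒜 : ℕ → AddSubgroup R) [GradedRing 𝒜] (hR0 : IsField (𝒜 0))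
    (ℬ : ℕ → AddSubgroup S) [GradedRing ℬ] (hS0 : IsField (ℬ 0))
    (hφ : ∀ (i : ℕ) (x : R), x ∈ 𝒜 i → algebraMap R S x ∈ ℬ i)
    (A : Type*) [AddCommGroup A] [Module R A] [Module.Finite R A] [Nontrivial A]
    (ℳ : ℕ → AddSubgroup A) [DirectSum.Decomposition ℳ] [SetLike.GradedSMul 𝒜 ℳ]
    (B : Type*) [AddCommGroup B] [Module R B] [Module S B] [IsScalarTower R S B]
    [Module.Finite S B] [Nontrivial B] [Module.Flat R B]
    (𝒩 : ℕ → AddSubgroup B) [DirectSum.Decomposition 𝒩] [SetLike.GradedSMul ℬ 𝒩] :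
    IsCohenMacaulayModule S (HomogeneousIdeal.irrelevant ℬ).toIdeal (A ⊗[R] B) ↔
      IsCohenMacaulayModule R (HomogeneousIdeal.irrelevant 𝒜).toIdeal A ∧
        IsCohenMacaulayModule S (HomogeneousIdeal.irrelevant ℬ).toIdeal
          (B ⧸ (Ideal.map (algebraMap R S) (HomogeneousIdeal.irrelevant 𝒜).toIdeal •
            (⊤ : Submodule S B))) :=
  (@isCohenMacaulayModule_congr S (A ⊗[R] B) (B ⊗[R] A) _ _ tensorRightModule _ tensorLeftModule _
    (tensorRightEquivLeft R S A B)).trans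
    (isCohenMacaulayModule_tensor_iff hR0 hS0 hφ A ℳ B 𝒩)
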